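/- arXiv:2111.04215 — 2 statements merged into one kernel-verified Lean document; each statement's English description precedes it below -/
import Mathlib

section
/- Let A₁ be the rational symmetric matrix [[0,0,1/2],[0,−1,0],[1/2,0,0]], and for an integral binary quartic form f = ax⁴+bx³y+cx²y²+dxy³+ey⁴ let B_f = [[a, b/2, 0],[b/2, c, d/2],[0, d/2, e]]. Call two rational symmetric 3×3 matrices B, B′ whose diagonal entries are integers and whose off-diagonal entries lie in ½ℤ equivalent if there exist g ∈ SL₃(ℤ) with g·A₁·gᵗ = A₁ and t ∈ ℤ such that B′ = g·B·gᵗ + t·A₁. Then the map f ↦ B_f induces a bijection between the orbits of the twisted GL₂(ℤ)-action on integral binary quartic forms and the equivalence classes of such matrices B; explicitly, (i) two integral binary quartic forms f, f′ lie in the same twisted GL₂(ℤ)-orbit if and only if B_f and B_{f′} are equivalent, and (ii) every rational symmetric 3×3 matrix B with integer diagonal entries and off-diagonal entries in ½ℤ is equivalent to B_f for some integral binary quartic form f. -/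
open Matrix

/-- The Gram matrix `A₁` of the ternary quadratic form `q² - pr`. -/
noncomputable def A1 : Matrix (Fin 3) (Fin 3) ℚ :=
  !![0, 0, 1/2; 0, -1, 0; 1/2, 0, 0]

/-- The symmetric matrix `B_f` attached to the integral binary quartic form
`f = ax⁴ + bx³y + cx²y² + dxy³ + ey⁴`. -/
noncomputable def Bmat (a b c d e : ℤ) : Matrix (Fin 3) (Fin 3) ℚ :=
  !![(a : ℚ), (b : ℚ)/2, 0; (b : ℚ)/2, (c : ℚ), (d : ℚ)/2; 0, (d : ℚ)/2, (e : ℚ)]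

/-- A rational symmetric 3×3 matrix with integer diagonal entries and off-diagonal
entries in `½ℤ`. -/
def IsHalfIntSymm (B : Matrix (Fin 3) (Fin 3) ℚ) : Prop :=
  B.IsSymm ∧ (∀ i, ∃ z : ℤ, B i i = (z : ℚ)) ∧
    ∀ i j, i ≠ j → ∃ z : ℤ, B i j = (z : ℚ)/2

/-- Equivalence of such matrices: `B' = g B gᵗ + t A₁` for some `g ∈ SL₃(ℤ)` fixing `A₁`
and some `t ∈ ℤ`. -/
def MatEquiv (B B' : Matrix (Fin 3) (Fin 3) ℚ) : Prop :=
  ∃ g : Matrix (Fin 3) (Fin 3) ℤ, g.det = 1 ∧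
    (g.map (Int.cast : ℤ → ℚ)) * A1 * (g.map (Int.cast : ℤ → ℚ))ᵀ = A1 ∧
    ∃ t : ℤ, B' = (g.map (Int.cast : ℤ → ℚ)) * B * (g.map (Int.cast : ℤ → ℚ))ᵀ + (t : ℚ) • A1

/-- Evaluation of the binary quartic form with coefficients `a₀, …, a₄` at `(x, y)`. -/
def quarticEval (a₀ a₁ a₂ a₃ a₄ x y : ℤ) : ℤ :=
  a₀ * x ^ 4 + a₁ * x ^ 3 * y + a₂ * x ^ 2 * y ^ 2 + a₃ * x * y ^ 3 + a₄ * y ^ 4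

/-- The twisted `GL₂(ℤ)`-equivalence of integral binary quartic forms (as coefficient
quintuples): `g = det(γ)⁻² · f((x,y)γ)` for some `γ = [[p,q],[r,s]]` with `det γ = ±1`,
written here without inverses as `det(γ)² · g(x,y) = f(px + ry, qx + sy)`. -/
def twistedGL2Equiv (f g : ℤ × ℤ × ℤ × ℤ × ℤ) : Prop :=
  ∃ p q r s : ℤ, (p * s - q * r = 1 ∨ p * s - q * r = -1) ∧
    ∀ x y : ℤ,
      (p * s - q * r) ^ 2 * quarticEval g.1 g.2.1 g.2.2.1 g.2.2.2.1 g.2.2.2.2 x y =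
        quarticEval f.1 f.2.1 f.2.2.1 f.2.2.2.1 f.2.2.2.2 (p * x + r * y) (q * x + s * y)

/-- The matrix of the action of `γ = [[p,q],[r,s]]` on `(x², xy, y²)`, multiplied by `det γ`
so that it has determinant `1` when `det γ = ±1`. -/
def twistedSymSq (p q r s : ℤ) : Matrix (Fin 3) (Fin 3) ℤ :=
  (p * s - q * r) • !![p ^ 2, p * q, q ^ 2; 2 * p * r, p * s + q * r, 2 * q * s;
    r ^ 2, r * s, s ^ 2]

theorem det_twistedSymSq {p q r s : ℤ} (h : (p * s - q * r) ^ 2 = 1) :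
    (twistedSymSq p q r s).det = 1 := by
  have h' : (twistedSymSq p q r s).det = ((p * s - q * r) ^ 2) ^ 3 := by
    simp [twistedSymSq, Matrix.det_fin_three]
    ring
  rw [h', h, one_pow]

theorem twistedSymSq_mul_A1_mul_transpose {p q r s : ℤ} (h : (p * s - q * r) ^ 2 = 1) :
    (twistedSymSq p q r s).map (Int.cast : ℤ → ℚ) * A1 *
      ((twistedSymSq p q r s).map (Int.cast : ℤ → ℚ))ᵀ = A1 := by
  have hD : ((p : ℚ) * s - q * r) ^ 2 = 1 := by exact_mod_cast h
  have hD4 : ((p : ℚ) * s - q * r) ^ 4 = 1 := by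
    rw [show 4 = 2 * 2 from rfl, pow_mul, hD, one_pow]
  ext i j
  fin_cases i <;> fin_cases j <;>
    simp [twistedSymSq, A1, Matrix.mul_apply, Fin.sum_univ_three] <;>
    first
    | ring1
    | linear_combination (1 / 2 : ℚ) * hD4
    | linear_combination -hD4

/-- A primitive integral zero of `ac - b²` is, up to sign, of the form `(p², pq, q²)`. -/
theorem exists_eq_sq_of_isCoprime {a b c : ℤ} (h : IsCoprime a c) (hb : a * c = b ^ 2) :
    ∃ ε p q : ℤ, (ε = 1 ∨ ε = -1) ∧ a = ε * p ^ 2 ∧ b = ε * (p * q) ∧ c = ε * q ^ 2 := by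
  obtain ⟨ε, p, hε, ha⟩ : ∃ ε p : ℤ, (ε = 1 ∨ ε = -1) ∧ a = ε * p ^ 2 := by
    obtain ⟨p, hp | hp⟩ := Int.sq_of_isCoprime h hb
    · exact ⟨1, p, Or.inl rfl, by simpa using hp⟩
    · exact ⟨-1, p, Or.inr rfl, by simpa using hp⟩
  have hεε : ε * ε = 1 := by rcases hε with rfl | rfl <;> rfl
  rcases eq_or_ne p 0 with rfl | hp
  · have ha0 : a = 0 := by simpa using ha
    subst ha0
    have hb0 : b = 0 := by simpa using hb.symm
    exact ⟨c, 0, 1, Int.isUnit_iff.mp (isCoprime_zero_left.mp h), by simp, by simp [hb0], by simp⟩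
  · have hdvd : p ∣ b := by
      rw [← Int.pow_dvd_pow_iff two_ne_zero, ← hb, ha]
      exact ⟨ε * c, by ring⟩
    obtain ⟨k, rfl⟩ := hdvd
    refine ⟨ε, p, ε * k, hε, ha, by linear_combination (-p * k) * hεε, ?_⟩
    have : p ^ 2 * (ε * c - k ^ 2) = 0 := by
      rw [ha] at hb
      linear_combination hb
    have hc : ε * c - k ^ 2 = 0 := by simpa [hp] using this
    linear_combination ε * hc - (c + ε * k ^ 2) * hεε

theorem isCoprime_of_bezout {a b c u v w : ℤ} (hb : a * c = b ^ 2)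
    (h : u * a + v * b + w * c = 1) : IsCoprime a c :=
  ⟨u * (1 + v * b) + v ^ 2 * c, w * (1 + v * b), by
    linear_combination (1 + v * b) * h + v ^ 2 * hb⟩

/-- Every element of `SL₃(ℤ)` preserving `A₁` comes from `GL₂(ℤ)`. -/
theorem exists_eq_twistedSymSq {g : Matrix (Fin 3) (Fin 3) ℤ} (hdet : g.det = 1)
    (hg : g.map (Int.cast : ℤ → ℚ) * A1 * (g.map (Int.cast : ℤ → ℚ))ᵀ = A1) :
    ∃ p q r s : ℤ, (p * s - q * r = 1 ∨ p * s - q * r = -1) ∧ g = twistedSymSq p q r s := by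
  have hform (i j : Fin 3) :
      (g i 0 : ℚ) * g j 2 + g i 2 * g j 0 - 2 * (g i 1 * g j 1) = 2 * A1 i j := by
    rw [← congr_fun₂ hg i j]
    simp [A1, Matrix.mul_apply, Fin.sum_univ_three]
    ring
  have h00 : g 0 0 * g 0 2 = g 0 1 ^ 2 := by
    have := hform 0 0
    simp [A1] at this
    have h : (g 0 0 : ℚ) * g 0 2 = g 0 1 ^ 2 := by linear_combination this / 2
    exact_mod_cast h
  have h22 : g 2 0 * g 2 2 = g 2 1 ^ 2 := by
    have := hform 2 2
    simp [A1] at this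
    have h : (g 2 0 : ℚ) * g 2 2 = g 2 1 ^ 2 := by linear_combination this / 2
    exact_mod_cast h
  have h02 : g 0 0 * g 2 2 + g 0 2 * g 2 0 - 2 * (g 0 1 * g 2 1) = 1 := by
    have := hform 0 2
    simp [A1] at this
    exact_mod_cast this
  have h01 : g 0 0 * g 1 2 + g 0 2 * g 1 0 - 2 * (g 0 1 * g 1 1) = 0 := by
    have := hform 0 1
    simp [A1] at this
    exact_mod_cast this
  have h21 : g 2 0 * g 1 2 + g 2 2 * g 1 0 - 2 * (g 2 1 * g 1 1) = 0 := by
    have := hform 2 1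
    simp [A1] at this
    exact_mod_cast this
  rw [Matrix.det_fin_three] at hdet
  obtain ⟨ε, p, q, hε, hp, hpq, hq⟩ := exists_eq_sq_of_isCoprime
    (isCoprime_of_bezout (u := g 2 2) (v := -2 * g 2 1) (w := g 2 0) h00
      (by linear_combination h02)) h00
  obtain ⟨ε', r, s, hε', hr, hrs, hs⟩ := exists_eq_sq_of_isCoprime
    (isCoprime_of_bezout (u := g 0 2) (v := -2 * g 0 1) (w := g 0 0) h22
      (by linear_combination h02)) h22
  rw [hp, hpq, hq] at h01 h02 hdet
  rw [hr, hrs, hs] at h21 h02 hdet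
  have hεε : ε * ε = 1 := by rcases hε with rfl | rfl <;> rfl
  have hprod : ε * ε' * (p * s - q * r) ^ 2 = 1 := by linear_combination h02
  have hε_eq : ε' = ε := by
    rcases hε with rfl | rfl <;> rcases hε' with rfl | rfl <;>
      first | rfl | nlinarith [sq_nonneg (p * s - q * r)]
  subst hε_eq
  have hD : (p * s - q * r) ^ 2 = 1 := by
    linear_combination hprod - (p * s - q * r) ^ 2 * hεε
  have e0 : g 1 0 * q ^ 2 - 2 * g 1 1 * (p * q) + g 1 2 * p ^ 2 = 0 := by
    linear_combination ε' * h01 -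
      (g 1 0 * q ^ 2 - 2 * g 1 1 * (p * q) + g 1 2 * p ^ 2) * hεε
  have e2 : g 1 0 * s ^ 2 - 2 * g 1 1 * (r * s) + g 1 2 * r ^ 2 = 0 := by
    linear_combination ε' * h21 -
      (g 1 0 * s ^ 2 - 2 * g 1 1 * (r * s) + g 1 2 * r ^ 2) * hεε
  have e1 : -(q * s) * g 1 0 + (p * s + q * r) * g 1 1 - p * r * g 1 2 = p * s - q * r := by
    linear_combination (p * s - q * r) * hdet -
      (-(q * s) * g 1 0 + (p * s + q * r) * g 1 1 - p * r * g 1 2) *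
        (ε' * ε' * hD + hεε)
  have h10 : g 1 0 = (p * s - q * r) * (2 * p * r) := by
    linear_combination r ^ 2 * e0 + p ^ 2 * e2 + 2 * p * r * e1 - g 1 0 * hD
  have h11 : g 1 1 = (p * s - q * r) * (p * s + q * r) := by
    linear_combination r * s * e0 + p * q * e2 + (p * s + q * r) * e1 - g 1 1 * hD
  have h12 : g 1 2 = (p * s - q * r) * (2 * q * s) := by
    linear_combination s ^ 2 * e0 + q ^ 2 * e2 + 2 * q * s * e1 - g 1 2 * hD
  have hD' : p * s - q * r = 1 ∨ p * s - q * r = -1 := sq_eq_one_iff.mp hD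
  by_cases h : ε' = p * s - q * r
  · refine ⟨p, q, r, s, hD', ?_⟩
    ext i j
    fin_cases i <;> fin_cases j <;> simp [twistedSymSq, *]
  · have h' : ε' = -p * s - -q * r := by grind
    refine ⟨-p, -q, r, s, by grind, ?_⟩
    rw [twistedSymSq, ← h']
    ext i j
    fin_cases i <;> fin_cases j <;> simp [hp, hpq, hq, hr, hrs, hs, h10, h11, h12] <;> grind

theorem quarticEval_eq_dotProduct (a b c d e x y : ℤ) :
    (quarticEval a b c d e x y : ℚ) =
      ![(x : ℚ) ^ 2, x * y, y ^ 2] ⬝ᵥ Bmat a b c d e *ᵥ ![(x : ℚ) ^ 2, x * y, y ^ 2] := by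
  simp [quarticEval, Bmat, Matrix.mulVec, dotProduct, Fin.sum_univ_three]
  ring

theorem dotProduct_A1_mulVec_eq_zero (x y : ℚ) :
    ![x ^ 2, x * y, y ^ 2] ⬝ᵥ A1 *ᵥ ![x ^ 2, x * y, y ^ 2] = 0 := by
  simp [A1, Matrix.mulVec, dotProduct, Fin.sum_univ_three]
  ring

theorem transpose_twistedSymSq_mulVec (p q r s x y : ℤ) :
    ((twistedSymSq p q r s).map (Int.cast : ℤ → ℚ))ᵀ *ᵥ ![(x : ℚ) ^ 2, x * y, y ^ 2] =
      ((p * s - q * r : ℤ) : ℚ) • ![((p * x + r * y : ℤ) : ℚ) ^ 2,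
        (p * x + r * y : ℤ) * (q * x + s * y : ℤ), ((q * x + s * y : ℤ) : ℚ) ^ 2] := by
  ext i
  fin_cases i <;> simp [twistedSymSq, Matrix.mulVec, dotProduct, Fin.sum_univ_three] <;> ring

/-- A symmetric matrix is determined, up to a multiple of `A₁`, by the quartic form it induces
on `(x², xy, y²)`. -/
theorem eq_Bmat_of_dotProduct_eq {M : Matrix (Fin 3) (Fin 3) ℚ} (hM : M.IsSymm)
    {a b c d e : ℤ} (h : ∀ x y : ℤ, (quarticEval a b c d e x y : ℚ) =
      ![(x : ℚ) ^ 2, x * y, y ^ 2] ⬝ᵥ M *ᵥ ![(x : ℚ) ^ 2, x * y, y ^ 2]) :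
    Bmat a b c d e = M + (-2 * M 0 2) • A1 := by
  have h1 := h 1 0
  have h2 := h 0 1
  have h3 := h 1 1
  have h4 := h 1 (-1)
  have h5 := h 2 1
  have s1 := hM.apply 0 1
  have s2 := hM.apply 0 2
  have s3 := hM.apply 1 2
  simp [quarticEval, Matrix.mulVec, dotProduct, Fin.sum_univ_three] at h1 h2 h3 h4 h5
  ext i j
  fin_cases i <;> fin_cases j <;> simp [Bmat, A1] <;> linarith

theorem two_mul_apply_zero_two_eq_intCast (g : Matrix (Fin 3) (Fin 3) ℤ) (a b c d e : ℤ) :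
    ∃ t : ℤ, -2 * (g.map (Int.cast : ℤ → ℚ) * Bmat a b c d e *
      (g.map (Int.cast : ℤ → ℚ))ᵀ) 0 2 = (t : ℚ) := by
  refine ⟨-(2 * g 0 0 * a * g 2 0 + b * (g 0 0 * g 2 1 + g 0 1 * g 2 0) +
    2 * g 0 1 * c * g 2 1 + d * (g 0 1 * g 2 2 + g 0 2 * g 2 1) + 2 * g 0 2 * e * g 2 2), ?_⟩
  simp [Bmat, Matrix.mul_apply, Fin.sum_univ_three]
  ring

theorem isSymm_Bmat (a b c d e : ℤ) : (Bmat a b c d e).IsSymm := by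
  ext i j
  fin_cases i <;> fin_cases j <;> simp [Bmat]

theorem dotProduct_conj_mulVec {n R : Type*} [Fintype n] [CommRing R]
    (g B : Matrix n n R) (v : n → R) :
    v ⬝ᵥ (g * B * gᵀ) *ᵥ v = (gᵀ *ᵥ v) ⬝ᵥ B *ᵥ (gᵀ *ᵥ v) := by
  rw [← Matrix.mulVec_mulVec, ← Matrix.mulVec_mulVec, Matrix.dotProduct_mulVec,
    ← Matrix.mulVec_transpose]

theorem dotProduct_twistedSymSq_conj {p q r s : ℤ} (h : (p * s - q * r) ^ 2 = 1)
    (a b c d e x y : ℤ) :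
    ![(x : ℚ) ^ 2, x * y, y ^ 2] ⬝ᵥ ((twistedSymSq p q r s).map (Int.cast : ℤ → ℚ) *
      Bmat a b c d e * ((twistedSymSq p q r s).map (Int.cast : ℤ → ℚ))ᵀ) *ᵥ
        ![(x : ℚ) ^ 2, x * y, y ^ 2] =
      quarticEval a b c d e (p * x + r * y) (q * x + s * y) := by
  have hD : ((p * s - q * r : ℤ) : ℚ) * ((p * s - q * r : ℤ) : ℚ) = 1 := by
    rw [← sq]
    exact_mod_cast h
  rw [dotProduct_conj_mulVec, transpose_twistedSymSq_mulVec, quarticEval_eq_dotProduct,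
    Matrix.mulVec_smul, smul_dotProduct, dotProduct_smul, smul_smul, hD, one_smul]

theorem twistedGL2Equiv_iff_matEquiv (f f' : ℤ × ℤ × ℤ × ℤ × ℤ) :
    twistedGL2Equiv f f' ↔
      MatEquiv (Bmat f.1 f.2.1 f.2.2.1 f.2.2.2.1 f.2.2.2.2)
        (Bmat f'.1 f'.2.1 f'.2.2.1 f'.2.2.2.1 f'.2.2.2.2) := by
  constructor
  · rintro ⟨p, q, r, s, hdet, h⟩
    have hD : (p * s - q * r) ^ 2 = 1 := sq_eq_one_iff.mpr hdet
    refine ⟨twistedSymSq p q r s, det_twistedSymSq hD, twistedSymSq_mul_A1_mul_transpose hD, ?_⟩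
    obtain ⟨t, ht⟩ := two_mul_apply_zero_two_eq_intCast (twistedSymSq p q r s)
      f.1 f.2.1 f.2.2.1 f.2.2.2.1 f.2.2.2.2
    refine ⟨t, ?_⟩
    rw [← ht]
    refine eq_Bmat_of_dotProduct_eq ?_ fun x y => ?_
    · rw [Matrix.IsSymm, Matrix.transpose_mul, Matrix.transpose_mul, Matrix.transpose_transpose,
        isSymm_Bmat, Matrix.mul_assoc]
    · rw [dotProduct_twistedSymSq_conj hD, ← h, hD, one_mul]
  · rintro ⟨g, hdet, hg, t, h⟩
    obtain ⟨p, q, r, s, hpqrs, rfl⟩ := exists_eq_twistedSymSq hdet hg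
    have hD : (p * s - q * r) ^ 2 = 1 := sq_eq_one_iff.mpr hpqrs
    refine ⟨p, q, r, s, hpqrs, fun x y => ?_⟩
    rw [hD, one_mul, ← Int.cast_inj (α := ℚ), quarticEval_eq_dotProduct, h, Matrix.add_mulVec,
      dotProduct_add, dotProduct_twistedSymSq_conj hD, Matrix.smul_mulVec, dotProduct_smul,
      dotProduct_A1_mulVec_eq_zero, smul_zero, add_zero]

theorem exists_matEquiv_Bmat {B : Matrix (Fin 3) (Fin 3) ℚ} (hB : IsHalfIntSymm B) :
    ∃ f : ℤ × ℤ × ℤ × ℤ × ℤ,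
      MatEquiv B (Bmat f.1 f.2.1 f.2.2.1 f.2.2.2.1 f.2.2.2.2) := by
  obtain ⟨hsymm, hdiag, hoff⟩ := hB
  obtain ⟨a, ha⟩ := hdiag 0
  obtain ⟨c, hc⟩ := hdiag 1
  obtain ⟨e, he⟩ := hdiag 2
  obtain ⟨b, hb⟩ := hoff 0 1 (by decide)
  obtain ⟨m, hm⟩ := hoff 0 2 (by decide)
  obtain ⟨d, hd⟩ := hoff 1 2 (by decide)
  have s1 := hsymm.apply 0 1
  have s2 := hsymm.apply 0 2
  have s3 := hsymm.apply 1 2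
  refine ⟨(a, b, c + m, d, e), 1, Matrix.det_one, ?_, -m, ?_⟩
  · simp [Matrix.map_one]
  · ext i j
    fin_cases i <;> fin_cases j <;> simp [Bmat, A1, Matrix.map_one, *] <;> ring

/-- The map `f ↦ B_f` induces a bijection between the orbits of the twisted
`GL₂(ℤ)`-action on integral binary quartic forms and the equivalence classes of rational
symmetric 3×3 matrices with integer diagonal and half-integer off-diagonal entries. -/
theorem binary_quartics_equiv_half_integral_matrices :
    (∀ f f' : ℤ × ℤ × ℤ × ℤ × ℤ,
      twistedGL2Equiv f f' ↔
        MatEquiv (Bmat f.1 f.2.1 f.2.2.1 f.2.2.2.1 f.2.2.2.2)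
          (Bmat f'.1 f'.2.1 f'.2.2.1 f'.2.2.2.1 f'.2.2.2.2)) ∧
    (∀ B : Matrix (Fin 3) (Fin 3) ℚ, IsHalfIntSymm B →
      ∃ f : ℤ × ℤ × ℤ × ℤ × ℤ,
        MatEquiv B (Bmat f.1 f.2.1 f.2.2.1 f.2.2.2.1 f.2.2.2.2)) :=
  ⟨twistedGL2Equiv_iff_matEquiv, fun _ => exists_matEquiv_Bmat⟩
end

section
/- Let r be a positive integer. Then the set of additive subgroups L of ℤ² such that the quotient group ℤ²/L is isomorphic to ℤ/rℤ is finite of cardinality ψ(r) = r·∏_{p prime, p ∣ r}(1 + 1/p), and every element of ℤ² lies in at least one such subgroup L. -/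
/-- The Dedekind ψ-function `ψ(r) = r·∏_{p ∣ r} (1 + 1/p)`. -/
noncomputable def dedekindPsi (r : ℕ) : ℚ :=
  r * ∏ p ∈ r.primeFactors, (1 + 1/(p : ℚ))

namespace CyclicQuotient

/-- The homomorphism `ℤ² → ℤ/rℤ` sending the standard basis to the two entries of `p`. -/
def pairHom {r : ℕ} (p : ZMod r × ZMod r) : ℤ × ℤ →+ ZMod r where
  toFun v := v.1 * p.1 + v.2 * p.2
  map_zero' := by simp
  map_add' v w := by push_cast [Prod.fst_add, Prod.snd_add]; ring

lemma pairHom_apply {r : ℕ} (p : ZMod r × ZMod r) (v : ℤ × ℤ) :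
    pairHom p v = v.1 * p.1 + v.2 * p.2 := rfl

lemma pairHom_surjective {r : ℕ} {p : ZMod r × ZMod r} (hp : IsCoprime p.1 p.2) :
    Function.Surjective (pairHom p) := by
  intro c
  obtain ⟨a, b, hab⟩ := hp
  obtain ⟨x, hx⟩ := ZMod.intCast_surjective (c * a)
  obtain ⟨y, hy⟩ := ZMod.intCast_surjective (c * b)
  refine ⟨(x, y), ?_⟩
  rw [pairHom_apply, hx, hy]
  linear_combination c * hab

lemma eq_pairHom {r : ℕ} (f : ℤ × ℤ →+ ZMod r) : f = pairHom (f (1, 0), f (0, 1)) := by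
  ext v
  have hv : v = v.1 • ((1, 0) : ℤ × ℤ) + v.2 • ((0, 1) : ℤ × ℤ) := by ext <;> simp
  conv_lhs => rw [hv, map_add, map_zsmul, map_zsmul, zsmul_eq_mul, zsmul_eq_mul]
  rfl

lemma isCoprime_of_surjective {r : ℕ} {p : ZMod r × ZMod r}
    (hp : Function.Surjective (pairHom p)) : IsCoprime p.1 p.2 := by
  obtain ⟨v, hv⟩ := hp 1
  exact ⟨v.1, v.2, hv⟩

lemma nonempty_quotient_ker_equiv {r : ℕ} {p : ZMod r × ZMod r} (hp : IsCoprime p.1 p.2) :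
    Nonempty ((ℤ × ℤ) ⧸ (pairHom p).ker ≃+ ZMod r) :=
  ⟨QuotientAddGroup.quotientKerEquivOfSurjective _ (pairHom_surjective hp)⟩

lemma exists_ker_eq {r : ℕ} {L : AddSubgroup (ℤ × ℤ)}
    (hL : Nonempty ((ℤ × ℤ) ⧸ L ≃+ ZMod r)) :
    ∃ p : ZMod r × ZMod r, IsCoprime p.1 p.2 ∧ (pairHom p).ker = L := by
  obtain ⟨e⟩ := hL
  let f : ℤ × ℤ →+ ZMod r := e.toAddMonoidHom.comp (QuotientAddGroup.mk' L)
  refine ⟨(f (1, 0), f (0, 1)), isCoprime_of_surjective ?_, ?_⟩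
  · rw [← eq_pairHom]
    exact e.surjective.comp (QuotientAddGroup.mk'_surjective L)
  · rw [← eq_pairHom]
    ext v
    simp [f]

lemma map_eq_mul_of_ker_le {r : ℕ} {f g : ℤ × ℤ →+ ZMod r} (h : f.ker ≤ g.ker)
    {v : ℤ × ℤ} (hv : f v = 1) (w : ℤ × ℤ) : g w = f w * g v := by
  obtain ⟨n, hn⟩ := ZMod.intCast_surjective (f w)
  have hker : w - n • v ∈ f.ker := by
    rw [AddMonoidHom.mem_ker, map_sub, map_zsmul, hv, zsmul_eq_mul, hn]
    ring
  have := h hker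
  rw [AddMonoidHom.mem_ker, map_sub, map_zsmul, zsmul_eq_mul, hn] at this
  exact sub_eq_zero.mp this

lemma exists_unit_smul_eq {r : ℕ} {p q : ZMod r × ZMod r} (hp : IsCoprime p.1 p.2)
    (hq : IsCoprime q.1 q.2) (h : (pairHom p).ker = (pairHom q).ker) :
    ∃ u : (ZMod r)ˣ, u • p = q := by
  obtain ⟨v, hv⟩ := pairHom_surjective hp 1
  obtain ⟨w, hw⟩ := pairHom_surjective hq 1
  have key := map_eq_mul_of_ker_le h.le hv
  have hu : pairHom q v * pairHom p w = 1 := by rw [mul_comm, ← key w, hw]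
  refine ⟨Units.mkOfMulEqOne _ _ hu, ?_⟩
  have h₁ := key (1, 0)
  have h₂ := key (0, 1)
  simp only [pairHom_apply p (1, 0), pairHom_apply q (1, 0), pairHom_apply p (0, 1),
    pairHom_apply q (0, 1), Int.cast_one, Int.cast_zero, one_mul, zero_mul, add_zero,
    zero_add] at h₁ h₂
  ext
  · simp [Units.smul_def, h₁, mul_comm]
  · simp [Units.smul_def, h₂, mul_comm]

lemma isCoprime_smul {r : ℕ} {p : ZMod r × ZMod r} (hp : IsCoprime p.1 p.2) (u : (ZMod r)ˣ) :
    IsCoprime (u • p).1 (u • p).2 := by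
  obtain ⟨a, b, hab⟩ := hp
  refine ⟨a * ↑u⁻¹, b * ↑u⁻¹, ?_⟩
  simp only [Prod.smul_fst, Prod.smul_snd, Units.smul_def, smul_eq_mul]
  linear_combination hab + (a * p.1 + b * p.2) * u.inv_mul

lemma ker_pairHom_smul {r : ℕ} (p : ZMod r × ZMod r) (u : (ZMod r)ˣ) :
    (pairHom (u • p)).ker = (pairHom p).ker := by
  ext v
  have : pairHom (u • p) v = u * pairHom p v := by
    simp only [pairHom_apply, Prod.smul_fst, Prod.smul_snd, Units.smul_def, smul_eq_mul]
    ring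
  rw [AddMonoidHom.mem_ker, AddMonoidHom.mem_ker, this, Units.mul_right_eq_zero]

lemma smul_left_injective_of_isCoprime {r : ℕ} {p : ZMod r × ZMod r}
    (hp : IsCoprime p.1 p.2) : Function.Injective fun u : (ZMod r)ˣ ↦ u • p := by
  intro u v h
  obtain ⟨a, b, hab⟩ := hp
  have h₁ := congrArg Prod.fst h
  have h₂ := congrArg Prod.snd h
  simp only [Prod.smul_fst, Prod.smul_snd, Units.smul_def, smul_eq_mul] at h₁ h₂
  ext
  linear_combination a * h₁ + b * h₂ - (u - v : ZMod r) * hab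

/-- The number of pairs in `R × R` generating the unit ideal. -/
noncomputable def coprimePairCount (R : Type*) [CommRing R] : ℕ :=
  Nat.card {p : R × R // IsCoprime p.1 p.2}

lemma coprimePairCount_eq (r : ℕ) [NeZero r] :
    coprimePairCount (ZMod r) = r.totient *
      {L : AddSubgroup (ℤ × ℤ) | Nonempty ((ℤ × ℤ) ⧸ L ≃+ ZMod r)}.ncard := by
  set S := {L : AddSubgroup (ℤ × ℤ) | Nonempty ((ℤ × ℤ) ⧸ L ≃+ ZMod r)} with hS
  choose s hs hker using fun L : S ↦ exists_ker_eq L.2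
  have hbij : Function.Bijective fun x : (ZMod r)ˣ × S ↦
      (⟨x.1 • s x.2, isCoprime_smul (hs x.2) x.1⟩ :
        {p : ZMod r × ZMod r // IsCoprime p.1 p.2}) := by
    constructor
    · rintro ⟨u, L⟩ ⟨v, M⟩ h
      have h' : u • s L = v • s M := congrArg Subtype.val h
      obtain rfl : L = M := by
        apply Subtype.ext
        rw [← hker L, ← hker M, ← ker_pairHom_smul (s L) u, h', ker_pairHom_smul]
      rw [smul_left_injective_of_isCoprime (hs L) h']
    · rintro ⟨p, hp⟩
      let L : S := ⟨(pairHom p).ker, nonempty_quotient_ker_equiv hp⟩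
      obtain ⟨u, hu⟩ := exists_unit_smul_eq (hs L) hp (hker L)
      exact ⟨(u, L), Subtype.ext hu⟩
  rw [coprimePairCount, ← Nat.card_congr (Equiv.ofBijective _ hbij), Nat.card_prod,
    Nat.card_eq_fintype_card, ZMod.card_units_eq_totient, Nat.card_coe_set_eq]

lemma isCoprime_prod_iff {R S : Type*} [CommRing R] [CommRing S] (x y : R × S) :
    IsCoprime x y ↔ IsCoprime x.1 y.1 ∧ IsCoprime x.2 y.2 := by
  constructor
  · exact fun h ↦ ⟨h.map (RingHom.fst R S), h.map (RingHom.snd R S)⟩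
  · rintro ⟨⟨a, b, h⟩, c, d, h'⟩
    exact ⟨(a, c), (b, d), Prod.ext h h'⟩

lemma coprimePairCount_congr {R S : Type*} [CommRing R] [CommRing S] (e : R ≃+* S) :
    coprimePairCount R = coprimePairCount S :=
  Nat.card_congr <| (Equiv.prodCongr e.toEquiv e.toEquiv).subtypeEquiv fun p ↦
    ⟨fun h ↦ h.map e.toRingHom, fun h ↦ by simpa using h.map e.symm.toRingHom⟩

lemma coprimePairCount_prod (R : Type*) (S : Type*) [CommRing R] [CommRing S] :
    coprimePairCount (R × S) = coprimePairCount R * coprimePairCount S := by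
  rw [coprimePairCount, coprimePairCount, coprimePairCount, ← Nat.card_prod]
  refine Nat.card_congr (((Equiv.prodProdProdComm R S R S).subtypeEquiv
    (q := fun x ↦ IsCoprime x.1.1 x.1.2 ∧ IsCoprime x.2.1 x.2.2)
    fun p ↦ isCoprime_prod_iff p.1 p.2).trans
    (Equiv.subtypeProdEquivProd (p := fun x : R × R ↦ IsCoprime x.1 x.2)
      (q := fun x : S × S ↦ IsCoprime x.1 x.2)))

lemma isCoprime_iff_isUnit_or_isUnit {R : Type*} [CommRing R] [IsLocalRing R] (a b : R) :
    IsCoprime a b ↔ IsUnit a ∨ IsUnit b := by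
  constructor
  · rintro ⟨x, y, h⟩
    exact (IsLocalRing.isUnit_or_isUnit_of_add_one h).imp isUnit_of_mul_isUnit_right
      isUnit_of_mul_isUnit_right
  · rintro (⟨u, rfl⟩ | ⟨u, rfl⟩)
    · exact ⟨↑u⁻¹, 0, by simp⟩
    · exact ⟨0, ↑u⁻¹, by simp⟩

lemma coprimePairCount_add_sq {R : Type*} [CommRing R] [IsLocalRing R] [Finite R] :
    coprimePairCount R + Nat.card {a : R // ¬ IsUnit a} ^ 2 = Nat.card R ^ 2 := by
  classical
  have h : Nat.card {p : R × R // ¬ IsCoprime p.1 p.2} = Nat.card {a : R // ¬ IsUnit a} ^ 2 := by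
    rw [sq, ← Nat.card_prod]
    refine Nat.card_congr (((Equiv.refl _).subtypeEquiv fun p ↦ ?_).trans
      Equiv.subtypeProdEquivProd)
    simp [isCoprime_iff_isUnit_or_isUnit]
  rw [← h, coprimePairCount, ← Nat.card_sum, sq, ← Nat.card_prod]
  exact Nat.card_congr (Equiv.sumCompl _)

lemma card_isUnit_add (R : Type*) [CommRing R] [Finite R] :
    Nat.card Rˣ + Nat.card {a : R // ¬ IsUnit a} = Nat.card R := by
  classical
  rw [Nat.card_congr (Submonoid.unitsTypeEquivIsUnitSubmonoid (M := R)).toEquiv, ← Nat.card_sum]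
  exact Nat.card_congr (Equiv.sumCompl _)

lemma coprimePairCount_zmod_prime_pow {p k : ℕ} (hp : p.Prime) (hk : k ≠ 0) :
    (coprimePairCount (ZMod (p ^ k)) : ℚ) = (p ^ k : ℚ) ^ 2 * (1 - 1 / (p : ℚ) ^ 2) := by
  have : Fact p.Prime := ⟨hp⟩
  have : NeZero (p ^ k) := ⟨pow_ne_zero _ hp.ne_zero⟩
  have : Fact (1 < p ^ k) := ⟨Nat.one_lt_pow hk hp.one_lt⟩
  have : IsLocalRing (ZMod (p ^ k)) :=
    .of_surjective' (PadicInt.toZModPow k) (ZMod.ringHom_surjective _)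
  have h₁ := coprimePairCount_add_sq (R := ZMod (p ^ k))
  have h₂ := card_isUnit_add (ZMod (p ^ k))
  rw [Nat.card_eq_fintype_card, ZMod.card_units_eq_totient, Nat.card_zmod,
    Nat.totient_prime_pow hp (Nat.pos_of_ne_zero hk)] at h₂
  rw [Nat.card_zmod] at h₁
  obtain ⟨m, rfl⟩ := Nat.exists_eq_add_one_of_ne_zero hk
  have hp0 : (p : ℚ) ≠ 0 := by exact_mod_cast hp.ne_zero
  have h₁' := congrArg (Nat.cast (R := ℚ)) h₁
  have h₂' := congrArg (Nat.cast (R := ℚ)) h₂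
  push_cast [Nat.cast_sub hp.one_le, Nat.add_sub_cancel] at h₁' h₂'
  have h₃ : (Nat.card {a : ZMod (p ^ (m + 1)) // ¬ IsUnit a} : ℚ) = p ^ m := by
    linear_combination h₂'
  rw [h₃] at h₁'
  field_simp
  linear_combination p ^ 2 * h₁'

lemma coprimePairCount_zmod (r : ℕ) (hr : r ≠ 0) :
    (coprimePairCount (ZMod r) : ℚ) =
      (r : ℚ) ^ 2 * ∏ p ∈ r.primeFactors, (1 - 1 / (p : ℚ) ^ 2) := by
  induction r using Nat.recOnPosPrimePosCoprime with
  | prime_pow p n hp hn =>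
    rw [coprimePairCount_zmod_prime_pow hp hn.ne', Nat.primeFactors_prime_pow hn.ne' hp]
    simp
  | zero => exact absurd rfl hr
  | one =>
    have : Nat.card {p : ZMod 1 × ZMod 1 // IsCoprime p.1 p.2} = 1 := by
      rw [Nat.card_eq_one_iff_unique]
      exact ⟨inferInstance, ⟨⟨(0, 0), 0, 0, Subsingleton.elim _ _⟩⟩⟩
    simp [coprimePairCount, this]
  | coprime a b ha hb hab iha ihb =>
    rw [coprimePairCount_congr (ZMod.chineseRemainder hab), coprimePairCount_prod,
      hab.primeFactors_mul, Finset.prod_union hab.disjoint_primeFactors]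
    push_cast
    rw [iha (by omega), ihb (by omega)]
    ring

lemma coprimePairCount_zmod_eq_totient_mul (r : ℕ) (hr : r ≠ 0) :
    (coprimePairCount (ZMod r) : ℚ) = r.totient * dedekindPsi r := by
  have h : ∏ p ∈ r.primeFactors, (1 - 1 / (p : ℚ) ^ 2) =
      (∏ p ∈ r.primeFactors, (1 - (p : ℚ)⁻¹)) * ∏ p ∈ r.primeFactors, (1 + 1 / (p : ℚ)) := by
    rw [← Finset.prod_mul_distrib]
    exact Finset.prod_congr rfl fun p _ ↦ by ring
  rw [coprimePairCount_zmod r hr, dedekindPsi, Nat.totient_eq_mul_prod_factors, h]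
  ring

lemma exists_isCoprime_orthogonal (v : ℤ × ℤ) :
    ∃ a b : ℤ, IsCoprime a b ∧ v.1 * a + v.2 * b = 0 := by
  obtain h | h := Nat.eq_zero_or_pos (Int.gcd v.1 v.2)
  · rw [Int.gcd_eq_zero_iff] at h
    exact ⟨1, 0, isCoprime_one_left, by simp [h.1]⟩
  · obtain ⟨x, y, hxy, h₁, h₂⟩ := Int.exists_gcd_one h
    refine ⟨-y, x, (Int.isCoprime_iff_gcd_eq_one.mpr hxy).symm.neg_left, ?_⟩
    linear_combination x * h₂ - y * h₁

end CyclicQuotient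

/-- For a positive integer `r`, there are exactly `ψ(r)` subgroups `L ≤ ℤ²` with
`ℤ²/L ≅ ℤ/rℤ`, and every element of `ℤ²` lies in at least one such subgroup. -/
theorem sublattices_with_cyclic_quotient (r : ℕ) (hr : 0 < r) :
    {L : AddSubgroup (ℤ × ℤ) | Nonempty ((ℤ × ℤ) ⧸ L ≃+ ZMod r)}.Finite ∧
    (({L : AddSubgroup (ℤ × ℤ) | Nonempty ((ℤ × ℤ) ⧸ L ≃+ ZMod r)}.ncard : ℚ)
      = dedekindPsi r) ∧
    ∀ v : ℤ × ℤ, ∃ L : AddSubgroup (ℤ × ℤ),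
      Nonempty ((ℤ × ℤ) ⧸ L ≃+ ZMod r) ∧ v ∈ L := by
  have : NeZero r := ⟨hr.ne'⟩
  refine ⟨?_, ?_, fun v ↦ ?_⟩
  · refine (Set.finite_range fun p : ZMod r × ZMod r ↦ (CyclicQuotient.pairHom p).ker).subset
      fun L hL ↦ ?_
    obtain ⟨p, -, hp⟩ := CyclicQuotient.exists_ker_eq hL
    exact ⟨p, hp⟩
  · have h := CyclicQuotient.coprimePairCount_zmod_eq_totient_mul r hr.ne'
    rw [CyclicQuotient.coprimePairCount_eq, Nat.cast_mul] at h
    exact mul_left_cancel₀ (by exact_mod_cast (Nat.totient_pos.mpr hr).ne') h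
  · obtain ⟨a, b, hab, hv⟩ := CyclicQuotient.exists_isCoprime_orthogonal v
    refine ⟨(CyclicQuotient.pairHom ((a : ZMod r), (b : ZMod r))).ker,
      CyclicQuotient.nonempty_quotient_ker_equiv (hab.map (Int.castRingHom (ZMod r))), ?_⟩
    rw [AddMonoidHom.mem_ker, CyclicQuotient.pairHom_apply]
    simpa using congrArg (Int.cast (R := ZMod r)) hv
end
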